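/- Let N ∈ {2,3} and let Ω be the open unit ball in ℝ^N. Let σ and n be positive constants with n² < σ. Then for every τ ∈ (0,1) there exist a sequence of positive numbers k_m with k_m → ∞ as m → ∞ and, for each m, a transmission eigenpair (u_m, v_m) for (k_m, σ, n) with neither u_m nor v_m identically zero, such that both ‖u_m‖_{L²(Ω_τ)} / ‖u_m‖_{L²(Ω)} → 0 and ‖v_m‖_{L²(Ω_τ)} / ‖v_m‖_{L²(Ω)} → 0 as m → ∞. -/

import Mathlib

open Metric MeasureTheory Filter Set

noncomputable section

/-- The divergence-form operator `∇·(σ(|x|)∇u)(x)` on `ℝ^N`,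
written as `∑ i ∂_i (σ(|y|) ∂_i u)(x)`. -/
def divSigmaGrad (N : ℕ) (σ : ℝ → ℝ) (u : EuclideanSpace ℝ (Fin N) → ℂ)
    (x : EuclideanSpace ℝ (Fin N)) : ℂ :=
  ∑ i : Fin N,
    fderiv ℝ (fun y => (σ ‖y‖ : ℂ) * fderiv ℝ u y (EuclideanSpace.single i 1)) x
      (EuclideanSpace.single i 1)

/-- The Laplacian `Δv(x) = ∑ i ∂_i ∂_i v (x)` on `ℝ^N`. -/
def lap (N : ℕ) (v : EuclideanSpace ℝ (Fin N) → ℂ) (x : EuclideanSpace ℝ (Fin N)) : ℂ :=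
  ∑ i : Fin N,
    fderiv ℝ (fun y => fderiv ℝ v y (EuclideanSpace.single i 1)) x (EuclideanSpace.single i 1)

/-- A transmission eigenpair `(u, v)` for `(k, σ(|x|), n(|x|))` on the open unit ball
`Ω ⊂ ℝ^N`: `u, v ∈ C²(Ω) ∩ C¹(closure Ω)`, not both identically zero, satisfying
`∇·(σ∇u) + k²n²u = 0` and `Δv + k²v = 0` in `Ω`, together with `u = v` and
`σ ∂u/∂ν = ∂v/∂ν` on `∂Ω` (where `ν(x) = x`). -/
def IsTransmissionEigenpair (N : ℕ) (k : ℝ) (σ n : ℝ → ℝ)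
    (u v : EuclideanSpace ℝ (Fin N) → ℂ) : Prop :=
  ContDiffOn ℝ 2 u (ball (0 : EuclideanSpace ℝ (Fin N)) 1) ∧
  ContDiffOn ℝ 1 u (closedBall (0 : EuclideanSpace ℝ (Fin N)) 1) ∧
  ContDiffOn ℝ 2 v (ball (0 : EuclideanSpace ℝ (Fin N)) 1) ∧
  ContDiffOn ℝ 1 v (closedBall (0 : EuclideanSpace ℝ (Fin N)) 1) ∧
  (∀ x ∈ ball (0 : EuclideanSpace ℝ (Fin N)) 1,
    divSigmaGrad N σ u x + (k : ℂ) ^ 2 * (n ‖x‖ : ℂ) ^ 2 * u x = 0) ∧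
  (∀ x ∈ ball (0 : EuclideanSpace ℝ (Fin N)) 1,
    lap N v x + (k : ℂ) ^ 2 * v x = 0) ∧
  (∀ x : EuclideanSpace ℝ (Fin N), ‖x‖ = 1 → u x = v x) ∧
  (∀ x : EuclideanSpace ℝ (Fin N), ‖x‖ = 1 →
    (σ 1 : ℂ) * fderivWithin ℝ u (closedBall (0 : EuclideanSpace ℝ (Fin N)) 1) x x
      = fderivWithin ℝ v (closedBall (0 : EuclideanSpace ℝ (Fin N)) 1) x x) ∧
  ¬ (EqOn u 0 (closedBall (0 : EuclideanSpace ℝ (Fin N)) 1) ∧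
     EqOn v 0 (closedBall (0 : EuclideanSpace ℝ (Fin N)) 1))

/-- The `L²` norm of `f` on the ball of radius `τ` centered at the origin. -/
def ballL2 (N : ℕ) (f : EuclideanSpace ℝ (Fin N) → ℂ) (τ : ℝ) : ℝ :=
  Real.sqrt (∫ x in ball (0 : EuclideanSpace ℝ (Fin N)) τ, ‖f x‖ ^ 2)


/-- The power series with coefficients `c`. -/
def pser (c : ℕ → ℝ) (t : ℝ) : ℝ := ∑' j, c j * t ^ j

/-- The coefficients of the derived series. -/
def dco (c : ℕ → ℝ) (j : ℕ) : ℝ := (j + 1) * c (j + 1)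

lemma dco_bound {c : ℕ → ℝ} (hc : ∀ j, |c j| ≤ 1 / (j.factorial : ℝ)) (j : ℕ) :
    |dco c j| ≤ 1 / (j.factorial : ℝ) := by
  unfold dco
  rw [abs_mul, abs_of_nonneg (by positivity)]
  have h := hc (j + 1)
  calc ((j : ℝ) + 1) * |c (j + 1)| ≤ (j + 1) * (1 / ((j + 1).factorial : ℝ)) := by gcongr
    _ = 1 / (j.factorial : ℝ) := by
      rw [Nat.factorial_succ]; push_cast
      have : (j.factorial : ℝ) ≠ 0 := by positivity
      field_simp

lemma pser_term_bound {c : ℕ → ℝ} (hc : ∀ j, |c j| ≤ 1 / (j.factorial : ℝ)) (t T : ℝ)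
    (hT : |t| ≤ T) (j : ℕ) : ‖c j * t ^ j‖ ≤ T ^ j / (j.factorial : ℝ) := by
  rw [Real.norm_eq_abs, abs_mul, abs_pow]
  have h0 : 0 ≤ T := (abs_nonneg t).trans hT
  calc |c j| * |t| ^ j ≤ (1 / (j.factorial : ℝ)) * T ^ j := by
        gcongr; exact hc j
    _ = _ := by ring

lemma pser_summable {c : ℕ → ℝ} (hc : ∀ j, |c j| ≤ 1 / (j.factorial : ℝ)) (t : ℝ) :
    Summable fun j => c j * t ^ j :=
  Summable.of_norm_bounded (Real.summable_pow_div_factorial |t|)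
    (fun j => pser_term_bound hc t |t| le_rfl j)

lemma pser_hasDerivAt {c : ℕ → ℝ} (hc : ∀ j, |c j| ≤ 1 / (j.factorial : ℝ)) (t : ℝ) :
    HasDerivAt (pser c) (pser (dco c) t) t := by
  set T := |t| + 1 with hT
  have h := hasDerivAt_tsum_of_isPreconnected (𝕜 := ℝ) (F := ℝ)
    (g := fun j (y : ℝ) => c j * y ^ j) (g' := fun j (y : ℝ) => c j * (j * y ^ (j - 1)))
    (u := fun j : ℕ => (j : ℝ) * T ^ (j - 1) / (j.factorial : ℝ)) (t := ball 0 T) (y₀ := 0) (y := t)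
    ?_ isOpen_ball ((convex_ball (0 : ℝ) T).isPreconnected) ?_ ?_ ?_ ?_ ?_
  · have e : (∑' j : ℕ, c j * (j * t ^ (j - 1))) = pser (dco c) t := by
      rw [Summable.tsum_eq_zero_add]
      · unfold pser dco
        simp
        refine tsum_congr fun j => ?_
        ring
      · rw [← summable_nat_add_iff 1]
        refine (pser_summable (dco_bound hc) t).congr fun j => ?_
        unfold dco; simp; ring
    rw [e] at h
    exact h
  · rw [← summable_nat_add_iff 1]
    refine (Real.summable_pow_div_factorial T).congr fun j => ?_
    rw [Nat.factorial_succ]; push_cast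
    have : (j.factorial : ℝ) ≠ 0 := by positivity
    field_simp
  · intro j y _
    exact (hasDerivAt_pow j y).const_mul (c j)
  · intro j y hy
    have hy' : |y| ≤ T := by simpa using (mem_ball_zero_iff.1 hy).le
    rw [Real.norm_eq_abs, abs_mul, abs_mul, abs_pow, Nat.abs_cast]
    calc |c j| * (j * |y| ^ (j - 1)) ≤ (1 / (j.factorial : ℝ)) * (j * T ^ (j - 1)) := by
          gcongr; exact hc j
      _ = _ := by ring
  · simp; positivity
  · exact pser_summable hc 0
  · simp [hT]

lemma pser_analytic {c : ℕ → ℝ} (hc : ∀ j, |c j| ≤ 1 / (j.factorial : ℝ)) :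
    AnalyticOnNhd ℝ (pser c) univ := by
  have hr : (FormalMultilinearSeries.ofScalars ℝ c).radius = ⊤ := by
    refine FormalMultilinearSeries.radius_eq_top_of_summable_norm _ fun r => ?_
    refine Summable.of_norm_bounded (Real.summable_pow_div_factorial r) fun j => ?_
    rw [FormalMultilinearSeries.ofScalars_norm, norm_mul, norm_norm, Real.norm_eq_abs]
    have h0 : (0:ℝ) ≤ r := r.2
    calc |c j| * ‖(r : ℝ) ^ j‖ ≤ (1 / (j.factorial : ℝ)) * (r : ℝ) ^ j := by
          rw [Real.norm_of_nonneg (by positivity)]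
          gcongr; exact hc j
      _ = _ := by ring
  have h := (FormalMultilinearSeries.ofScalars ℝ c).hasFPowerSeriesOnBall (by rw [hr]; simp)
  have e : (FormalMultilinearSeries.ofScalars ℝ c).sum = pser c := by
    ext t
    change FormalMultilinearSeries.ofScalarsSum c t = _
    rw [FormalMultilinearSeries.ofScalarsSum_eq_tsum]
    simp [pser]
  rw [e, hr] at h
  intro x _
  exact h.analyticOnNhd x (by simp)

/-- Coefficients of the normalized Bessel series. -/
def bco (a : ℝ) (j : ℕ) : ℝ := (-1) ^ j / (j.factorial * ∏ i ∈ Finset.range j, (a + i))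

lemma bco_bound {a : ℝ} (ha : 1 ≤ a) (j : ℕ) : |bco a j| ≤ 1 / (j.factorial : ℝ) := by
  unfold bco
  have h1 : (1:ℝ) ≤ ∏ i ∈ Finset.range j, (a + i) := by
    have := Finset.prod_le_prod (s := Finset.range j) (f := fun _ => (1:ℝ))
      (g := fun i : ℕ => a + i) (by intros; simp)
      (by intro i _; have : (0:ℝ) ≤ i := by positivity
          linarith)
    simpa using this
  rw [abs_div, abs_pow, abs_neg, abs_one, one_pow, abs_of_nonneg (by positivity)]
  have : (0:ℝ) < j.factorial := by positivity
  gcongr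
  nlinarith

lemma bco_succ {a : ℝ} (ha : 1 ≤ a) (j : ℕ) : (j + 1) * (a + j) * bco a (j + 1) = - bco a j := by
  unfold bco
  rw [Finset.prod_range_succ, Nat.factorial_succ]
  have h1 : (∏ i ∈ Finset.range j, (a + i)) ≠ 0 := by
    refine Finset.prod_ne_zero_iff.2 fun i _ => ?_
    have : (0:ℝ) ≤ i := by positivity
    linarith
  have h2 : a + j ≠ 0 := by
    have : (0:ℝ) ≤ j := by positivity
    linarith
  have : (j.factorial : ℝ) ≠ 0 := by positivity
  push_cast
  field_simp
  ring

/-- Existence of the entire normalized Bessel function. -/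
lemma exists_bessel {a : ℝ} (ha : 1 ≤ a) : ∃ g g1 g2 : ℝ → ℝ,
    AnalyticOnNhd ℝ g univ ∧ (∀ t, HasDerivAt g (g1 t) t) ∧ (∀ t, HasDerivAt g1 (g2 t) t) ∧
    g 0 = 1 ∧ ∀ t, t * g2 t + a * g1 t + g t = 0 := by
  have hc := bco_bound ha
  refine ⟨pser (bco a), pser (dco (bco a)), pser (dco (dco (bco a))), pser_analytic hc,
    pser_hasDerivAt hc, pser_hasDerivAt (dco_bound hc), ?_, ?_⟩
  · unfold pser
    rw [tsum_eq_single 0 (by intro j hj; simp [hj])]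
    simp [bco]
  · intro t
    have s0 := pser_summable hc t
    have s1 := pser_summable (dco_bound hc) t
    have s2 := pser_summable (dco_bound (dco_bound hc)) t
    have s3 : Summable fun j : ℕ => (j:ℝ) * (j + 1) * bco a (j + 1) * t ^ j := by
      rw [← summable_nat_add_iff 1]
      refine (s2.mul_left t).congr fun j => ?_
      simp only [dco]; push_cast; ring
    have e : t * pser (dco (dco (bco a))) t = ∑' j : ℕ, (j:ℝ) * (j + 1) * bco a (j + 1) * t ^ j := by
      rw [s3.tsum_eq_zero_add]
      unfold pser
      rw [← tsum_mul_left]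
      simp
      refine tsum_congr fun j => ?_
      simp only [dco]; push_cast; ring
    rw [e]
    unfold pser
    rw [← tsum_mul_left, ← s3.tsum_add (s1.mul_left a), ← (s3.add (s1.mul_left a)).tsum_add s0]
    convert tsum_zero with j
    have := bco_succ ha j
    simp only [dco]
    linear_combination t ^ j * this

/-- The data of the normalized Bessel function of order `ν`. -/
structure Bes (ν : ℝ) (g g1 g2 : ℝ → ℝ) : Prop where
  an : AnalyticOnNhd ℝ g univ
  d1 : ∀ t, HasDerivAt g (g1 t) t
  d2 : ∀ t, HasDerivAt g1 (g2 t) t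
  z : g 0 = 1
  ode : ∀ t, t * g2 t + (ν + 1) * g1 t + g t = 0

lemma Bes.cont {ν : ℝ} {g g1 g2 : ℝ → ℝ} (h : Bes ν g g1 g2) : Continuous g :=
  continuous_iff_continuousAt.2 fun t => (h.d1 t).continuousAt

lemma Bes.cont1 {ν : ℝ} {g g1 g2 : ℝ → ℝ} (h : Bes ν g g1 g2) : Continuous g1 :=
  continuous_iff_continuousAt.2 fun t => (h.d2 t).continuousAt

lemma Bes.growth_aux {ν : ℝ} {g g1 g2 : ℝ → ℝ} (h : Bes ν g g1 g2) (hν : 0 < ν) {ρ T : ℝ}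
    (hρ : 0 ≤ ρ) (hT : 4 * T ≤ ν ^ 2 - ρ ^ 2) (hg : ∀ t ∈ Ioo 0 T, 0 ≤ g t)
    {t : ℝ} (ht : t ∈ Ioc 0 T) : 0 ≤ (ν - ρ) * g t + 2 * t * g1 t := by
  have hc := h.cont
  have hc1 := h.cont1
  have hmono : MonotoneOn (fun t : ℝ => t ^ ((ρ + ν) / 2) * ((ν - ρ) * g t + 2 * t * g1 t))
      (Icc 0 T) := by
    refine monotoneOn_of_hasDerivWithinAt_nonneg (convex_Icc 0 T)
      (f' := fun t => ((ρ + ν) / 2 * t ^ ((ρ + ν) / 2 - 1)) * ((ν - ρ) * g t + 2 * t * g1 t)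
        + t ^ ((ρ + ν) / 2) * ((ν - ρ) * g1 t + (2 * 1 * g1 t + 2 * t * g2 t))) ?_ ?_ ?_
    · refine Continuous.continuousOn ?_
      refine (Real.continuous_rpow_const (by positivity)).mul (by fun_prop)
    · intro x hx
      rw [interior_Icc] at hx
      refine HasDerivAt.hasDerivWithinAt ?_
      refine (Real.hasDerivAt_rpow_const (Or.inl hx.1.ne')).mul ?_
      refine ((h.d1 x).const_mul _).add ?_
      exact ((hasDerivAt_id x).const_mul 2).mul (h.d2 x)
    · intro x hx
      rw [interior_Icc] at hx
      have e : x ^ ((ρ + ν) / 2) = x ^ ((ρ + ν) / 2 - 1) * x := by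
        rw [Real.rpow_sub_one hx.1.ne']
        have := hx.1.ne'
        field_simp
      rw [e]
      have e2 : ((ρ + ν) / 2 * x ^ ((ρ + ν) / 2 - 1)) * ((ν - ρ) * g x + 2 * x * g1 x)
        + x ^ ((ρ + ν) / 2 - 1) * x * ((ν - ρ) * g1 x + (2 * 1 * g1 x + 2 * x * g2 x))
          = x ^ ((ρ + ν) / 2 - 1) * (((ν ^ 2 - ρ ^ 2) - 4 * x) / 2 * g x) := by
        linear_combination (2 * x * x ^ ((ρ + ν) / 2 - 1)) * h.ode x
      rw [e2]
      have h1 := hx.1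
      have h2 := hx.2
      have : 0 ≤ x ^ ((ρ + ν) / 2 - 1) := Real.rpow_nonneg hx.1.le _
      have h3 := hg x hx
      have : 0 ≤ ((ν ^ 2 - ρ ^ 2) - 4 * x) / 2 := by linarith
      positivity
  have hT0 : 0 ≤ T := ht.1.le.trans ht.2
  have h2 := hmono (left_mem_Icc.2 hT0) ⟨ht.1.le, ht.2⟩ ht.1.le
  simp only at h2
  rw [Real.zero_rpow (by positivity), zero_mul] at h2
  exact nonneg_of_mul_nonneg_right h2 (Real.rpow_pos_of_pos ht.1 _)

lemma Bes.growth {ν : ℝ} {g g1 g2 : ℝ → ℝ} (h : Bes ν g g1 g2) (hν : 0 < ν) {ρ T : ℝ}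
    (hρ : 0 ≤ ρ) (hT : 4 * T ≤ ν ^ 2 - ρ ^ 2) (hg : ∀ t ∈ Ioo 0 T, 0 ≤ g t) :
    MonotoneOn (fun t : ℝ => t ^ ((ν - ρ) / 2) * g t) (Ioc 0 T) := by
  have hc := h.cont
  refine monotoneOn_of_hasDerivWithinAt_nonneg (convex_Ioc 0 T)
      (f' := fun t => ((ν - ρ) / 2 * t ^ ((ν - ρ) / 2 - 1)) * g t
        + t ^ ((ν - ρ) / 2) * g1 t) ?_ ?_ ?_
  · refine ContinuousOn.mul ?_ hc.continuousOn
    intro x hx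
    exact (Real.continuousAt_rpow_const x _ (Or.inl hx.1.ne')).continuousWithinAt
  · intro x hx
    rw [interior_Ioc] at hx
    exact ((Real.hasDerivAt_rpow_const (Or.inl hx.1.ne')).mul (h.d1 x)).hasDerivWithinAt
  · intro x hx
    rw [interior_Ioc] at hx
    have e : x ^ ((ν - ρ) / 2) = x ^ ((ν - ρ) / 2 - 1) * x := by
      rw [Real.rpow_sub_one hx.1.ne']
      have := hx.1.ne'
      field_simp
    rw [e]
    have e2 : ((ν - ρ) / 2 * x ^ ((ν - ρ) / 2 - 1)) * g x + x ^ ((ν - ρ) / 2 - 1) * x * g1 x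
        = x ^ ((ν - ρ) / 2 - 1) * (((ν - ρ) * g x + 2 * x * g1 x) / 2) := by ring
    rw [e2]
    have : 0 ≤ x ^ ((ν - ρ) / 2 - 1) := Real.rpow_nonneg hx.1.le _
    have := h.growth_aux hν hρ hT hg ⟨hx.1, hx.2.le⟩
    positivity

lemma Bes.pos {ν : ℝ} {g g1 g2 : ℝ → ℝ} (h : Bes ν g g1 g2) (hν : 0 < ν) {t : ℝ}
    (ht0 : 0 ≤ t) (ht : 4 * t ≤ ν ^ 2) : 0 < g t := by
  by_contra hcon
  push Not at hcon
  have hK : IsCompact {s | s ∈ Icc 0 t ∧ g s ≤ 0} :=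
    isCompact_Icc.inter_right (isClosed_le h.cont continuous_const)
  obtain ⟨t0, ⟨⟨h0, h1⟩, h2⟩, hmin⟩ := hK.exists_isLeast ⟨t, ⟨ht0, le_rfl⟩, hcon⟩
  have hpos : ∀ s, 0 ≤ s → s < t0 → 0 < g s := by
    intro s hs hst
    by_contra hc
    push Not at hc
    exact absurd (hmin ⟨⟨hs, hst.le.trans h1⟩, hc⟩) (not_le.2 hst)
  have ht0' : 0 < t0 := by
    rcases h0.lt_or_eq with h3 | h3
    · exact h3
    · rw [← h3, h.z] at h2; linarith
  have hm := h.growth hν (ρ := 0) (T := t0) le_rfl (by nlinarith)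
    (fun s hs => (hpos s hs.1.le hs.2).le)
    (show t0 / 2 ∈ Ioc 0 t0 from ⟨by linarith, by linarith⟩) (right_mem_Ioc.2 ht0') (by linarith)
  simp only at hm
  have h3 : 0 < (t0 / 2) ^ ((ν - 0) / 2) * g (t0 / 2) :=
    mul_pos (Real.rpow_pos_of_pos (by linarith) _) (hpos _ (by linarith) (by linarith))
  have h4 : t0 ^ ((ν - 0) / 2) * g t0 ≤ 0 :=
    mul_nonpos_of_nonneg_of_nonpos (Real.rpow_nonneg h0 _) h2
  linarith

/-- Scaled growth estimate. -/
lemma Bes.scale {ν : ℝ} {g g1 g2 : ℝ → ℝ} (h : Bes ν g g1 g2) (hν : 0 < ν) {ρ T μ t : ℝ}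
    (hρ : 0 ≤ ρ) (hT : 4 * T ≤ ν ^ 2 - ρ ^ 2) (hμ : 1 ≤ μ) (ht : 0 ≤ t) (htT : μ ^ 2 * t ≤ T) :
    0 ≤ g t ∧ g t ≤ μ ^ (ν - ρ) * g (μ ^ 2 * t) := by
  have hpos : ∀ s, 0 ≤ s → s ≤ T → 0 < g s := fun s hs hsT => h.pos hν hs (by nlinarith)
  have hμ2 : 1 ≤ μ ^ 2 := by nlinarith
  have htt : t ≤ μ ^ 2 * t := by nlinarith
  refine ⟨(hpos t ht (htt.trans htT)).le, ?_⟩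
  rcases ht.lt_or_eq with h0 | h0
  · have hm := h.growth hν hρ hT (fun s hs => (hpos s hs.1.le hs.2.le).le)
      (⟨h0, htt.trans htT⟩ : t ∈ Ioc 0 T) (⟨by positivity, htT⟩ : μ ^ 2 * t ∈ Ioc 0 T) htt
    simp only at hm
    rw [Real.mul_rpow (by positivity) ht, ← Real.rpow_natCast μ 2,
      ← Real.rpow_mul (by linarith)] at hm
    have e : ((2:ℕ):ℝ) * ((ν - ρ) / 2) = ν - ρ := by push_cast; ring
    rw [e, Real.rpow_natCast] at hm
    have hp : 0 < t ^ ((ν - ρ) / 2) := Real.rpow_pos_of_pos h0 _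
    refine le_of_mul_le_mul_left (a := t ^ ((ν - ρ) / 2)) ?_ hp
    linarith
  · rw [← h0, mul_zero, h.z, mul_one]
    refine Real.one_le_rpow hμ ?_
    have : 0 ≤ T := by rw [← h0] at htT; simpa using htT
    nlinarith

/-- Sturm oscillation. -/
lemma osc {y y1 Q : ℝ → ℝ} {A q : ℝ} (hq : 0 < q) (hy : ∀ x, HasDerivAt y (y1 x) x)
    (hy1 : ∀ x, HasDerivAt y1 (-(Q x * y x)) x)
    (hQ : ∀ x ∈ Ioo A (A + Real.pi / q), q ^ 2 < Q x)
    (hne : ∃ x ∈ Ioo A (A + Real.pi / q), y x ≠ 0) :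
    ∃ x ∈ Icc A (A + Real.pi / q), y x < 0 := by
  by_contra hcon
  push Not at hcon
  set B := A + Real.pi / q with hB
  have hAB : A ≤ B := by have := Real.pi_pos; rw [hB]; have : 0 < Real.pi / q := by positivity
                         linarith
  set W : ℝ → ℝ := fun x => y1 x * Real.sin (q * (x - A)) - y x * (q * Real.cos (q * (x - A)))
    with hW
  have hd : ∀ x, HasDerivAt W ((q ^ 2 - Q x) * y x * Real.sin (q * (x - A))) x := by
    intro x
    have h0 : HasDerivAt (fun x => q * (x - A)) q x := by
      simpa using ((hasDerivAt_id x).sub_const A).const_mul q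
    have := ((hy1 x).mul h0.sin).sub ((hy x).mul (h0.cos.const_mul q))
    convert! this using 1
    ring
  have hsin : ∀ x ∈ Ioo A B, 0 < Real.sin (q * (x - A)) := by
    intro x hx
    refine Real.sin_pos_of_pos_of_lt_pi (mul_pos hq (by linarith [hx.1])) ?_
    have : x - A < Real.pi / q := by have := hx.2; rw [hB] at this; linarith
    rw [lt_div_iff₀ hq] at this
    linarith
  have hanti : AntitoneOn W (Icc A B) := by
    refine antitoneOn_of_hasDerivWithinAt_nonpos (convex_Icc A B)
      (fun x _ => (hd x).continuousAt.continuousWithinAt)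
      (fun x _ => (hd x).hasDerivWithinAt) ?_
    intro x hx
    rw [interior_Icc] at hx
    have h1 := hQ x hx
    have h2 := hcon x (Ioo_subset_Icc_self hx)
    have h3 := hsin x hx
    have : 0 ≤ (Q x - q ^ 2) * y x * Real.sin (q * (x - A)) := by
      have : 0 ≤ Q x - q ^ 2 := by linarith
      positivity
    linarith
  have hWA : W A ≤ 0 := by
    have := hcon A (left_mem_Icc.2 hAB)
    simp only [hW, sub_self, mul_zero, Real.sin_zero, Real.cos_zero]
    nlinarith
  have hWB : 0 ≤ W B := by
    have := hcon B (right_mem_Icc.2 hAB)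
    have e : q * (B - A) = Real.pi := by rw [hB]; field_simp; ring
    simp only [hW, e, Real.sin_pi, Real.cos_pi]
    nlinarith
  obtain ⟨x0, hx0, hne⟩ := hne
  have hWz : ∀ x ∈ Icc A B, W x = 0 := by
    intro x hx
    have h1 := hanti (left_mem_Icc.2 hAB) hx hx.1
    have h2 := hanti hx (right_mem_Icc.2 hAB) hx.2
    linarith
  have hd0 : HasDerivAt W 0 x0 := by
    refine (hasDerivAt_const x0 (0:ℝ)).congr_of_eventuallyEq ?_
    filter_upwards [Icc_mem_nhds hx0.1 hx0.2] with x hx using hWz x hx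
  have := (hd x0).unique hd0
  have h1 := hQ x0 hx0
  have h3 := hsin x0 hx0
  rcases mul_eq_zero.1 this with h4 | h4
  · rcases mul_eq_zero.1 h4 with h5 | h5
    · linarith
    · exact hne h5
  · linarith

lemma Bes.ne {ν : ℝ} {g g1 g2 : ℝ → ℝ} (h : Bes ν g g1 g2) {A B : ℝ} (hAB : A < B) :
    ∃ x ∈ Ioo A B, g (Real.exp (2 * x) / 4) ≠ 0 := by
  by_contra hcon
  push Not at hcon
  set x0 := (A + B) / 2 with hx0
  have hmem : x0 ∈ Ioo A B := ⟨by rw [hx0]; linarith, by rw [hx0]; linarith⟩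
  set t0 := Real.exp (2 * x0) / 4 with ht0
  have ht0p : 0 < t0 := by rw [ht0]; positivity
  have hz : g =ᶠ[nhds t0] 0 := by
    have hct : ContinuousAt (fun t : ℝ => Real.log (4 * t) / 2) t0 := by
      refine ContinuousAt.div_const ?_ 2
      refine ContinuousAt.log (by fun_prop) (by positivity)
    have e : Real.log (4 * t0) / 2 = x0 := by
      rw [ht0, mul_div_cancel₀ _ (by norm_num), Real.log_exp]; ring
    have hnh : (fun t : ℝ => Real.log (4 * t) / 2) ⁻¹' (Ioo A B) ∈ nhds t0 :=
      hct.preimage_mem_nhds (by rw [e]; exact Ioo_mem_nhds hmem.1 hmem.2)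
    filter_upwards [hnh, lt_mem_nhds ht0p] with t ht htp
    have := hcon _ ht
    rwa [mul_div_cancel₀ _ (by norm_num), Real.exp_log (by positivity),
      mul_div_cancel_left₀ _ (by norm_num)] at this
  have := h.an.eqOn_zero_of_preconnected_of_eventuallyEq_zero isPreconnected_univ (mem_univ t0) hz
    (mem_univ 0)
  rw [h.z] at this
  simp at this

lemma Bes.eig {ν : ℝ} {g g1 g2 : ℝ → ℝ} (h : Bes ν g g1 g2) (hν : 0 < ν)
    {m σ ε Λ Λ0 q : ℝ} (hε : 0 < ε) (hΛ0 : 1 < Λ0) (hq : 0 < q)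
    (hq2 : q ^ 2 = ν ^ 2 * (Λ0 ^ 2 - 1)) (hΛ : 0 < Λ) (hεΛ : ε * Λ ≤ 1)
    (hlog : Real.log (ν * Λ0) + 3 * (Real.pi / q) ≤ Real.log (ν * Λ)) :
    ∃ k, ν ≤ k ∧ k ≤ ν * Λ ∧ 0 < g (k ^ 2 / 4) ∧ 0 < g (ε ^ 2 * (k ^ 2 / 4)) ∧
      σ * (m * g (ε ^ 2 * (k ^ 2 / 4)) + 2 * (ε ^ 2 * (k ^ 2 / 4)) * g1 (ε ^ 2 * (k ^ 2 / 4)))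
        * g (k ^ 2 / 4)
      = (m * g (k ^ 2 / 4) + 2 * (k ^ 2 / 4) * g1 (k ^ 2 / 4)) * g (ε ^ 2 * (k ^ 2 / 4)) := by
  set A := Real.log (ν * Λ0) with hA
  set d := Real.pi / q with hd
  have hdp : 0 < d := by have := Real.pi_pos; positivity
  set E : ℝ → ℝ := fun x => Real.exp (2 * x) / 4 with hE
  have hEd : ∀ x, HasDerivAt E (2 * E x) x := by
    intro x
    have := (((hasDerivAt_id x).const_mul 2).exp).div_const 4
    convert! this using 1
    simp [hE]; ring
  have hge : ∀ x, HasDerivAt (fun x => g (E x)) (g1 (E x) * (2 * E x)) x :=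
    fun x => (h.d1 (E x)).comp x (hEd x)
  have hg1e : ∀ x, HasDerivAt (fun x => g1 (E x)) (g2 (E x) * (2 * E x)) x :=
    fun x => (h.d2 (E x)).comp x (hEd x)
  have hexp : ∀ x, HasDerivAt (fun x => Real.exp (ν * x)) (ν * Real.exp (ν * x)) x := by
    intro x
    have := ((hasDerivAt_id x).const_mul ν).exp
    convert! this using 1
    simp; ring
  set y : ℝ → ℝ := fun x => Real.exp (ν * x) * g (E x) with hy
  set y1 : ℝ → ℝ := fun x => Real.exp (ν * x) * (ν * g (E x) + 2 * E x * g1 (E x)) with hy1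
  have hyd : ∀ x, HasDerivAt y (y1 x) x := by
    intro x
    have := (hexp x).mul (hge x)
    convert! this using 1
    simp [hy1]; ring
  have hy1d : ∀ x, HasDerivAt y1 (-((4 * E x - ν ^ 2) * y x)) x := by
    intro x
    have := (hexp x).mul (((hge x).const_mul ν).add (((hEd x).const_mul 2).mul (hg1e x)))
    convert! this using 1
    simp only [hy, Pi.add_apply, Pi.mul_apply]
    linear_combination (-4 * E x * Real.exp (ν * x)) * h.ode (E x)
  have hQ : ∀ x, A < x → q ^ 2 < 4 * E x - ν ^ 2 := by
    intro x hx
    have h1 : ν * Λ0 < Real.exp x := by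
      rw [hA] at hx
      rwa [Real.log_lt_iff_lt_exp (by positivity)] at hx
    have h2 : 4 * E x = Real.exp x ^ 2 := by
      simp only [hE]; rw [← Real.exp_nat_mul]; push_cast; ring
    rw [h2, hq2]
    have : (ν * Λ0) ^ 2 < Real.exp x ^ 2 := by gcongr
    nlinarith
  have hneY : ∀ A' : ℝ, ∃ x ∈ Ioo A' (A' + d), y x ≠ 0 := by
    intro A'
    obtain ⟨x, hx, hx2⟩ := h.ne (show A' < A' + d by linarith)
    exact ⟨x, hx, mul_ne_zero (Real.exp_pos _).ne' hx2⟩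
  have hneg : ∀ A', A ≤ A' → ∃ x ∈ Icc A' (A' + d), g (E x) < 0 := by
    intro A' hA'
    obtain ⟨x, hx, hx2⟩ := osc hq hyd hy1d (A := A') (fun x hx => hQ x (hA'.trans_lt hx.1)) (hneY A')
    exact ⟨x, hx, neg_of_mul_neg_right hx2 (Real.exp_pos _).le⟩
  have hpos : ∀ A', A ≤ A' → ∃ x ∈ Icc A' (A' + d), 0 < g (E x) := by
    intro A' hA'
    obtain ⟨x0, hx0, hx0n⟩ := hneY A'
    obtain ⟨x, hx, hx2⟩ := osc (y := fun x => -y x) (y1 := fun x => -y1 x)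
      (Q := fun x => 4 * E x - ν ^ 2) hq (fun x => (hyd x).neg)
      (fun x => by
        have := (hy1d x).neg
        convert! this using 1
        ring) (A := A') (fun x hx => hQ x (hA'.trans_lt hx.1))
      ⟨x0, hx0, neg_ne_zero.2 hx0n⟩
    refine ⟨x, hx, ?_⟩
    have : 0 < y x := by simpa using hx2
    exact pos_of_mul_pos_right this (Real.exp_pos _).le
  obtain ⟨a, ha, hga⟩ := hneg A le_rfl
  obtain ⟨b, hb, hgb⟩ := hpos (A + d) (by linarith)
  obtain ⟨c, hc, hgc⟩ := hneg (A + d + d) (by linarith)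
  -- positivity of the second factor
  have hk2 : ∀ x, 4 * E x = Real.exp x ^ 2 := by
    intro x
    simp only [hE]; rw [← Real.exp_nat_mul]; push_cast; ring
  have hle : ∀ x, x ≤ c → Real.exp x ≤ ν * Λ := by
    intro x hx
    have h1 : x ≤ Real.log (ν * Λ) := by linarith [hc.2]
    rwa [Real.le_log_iff_exp_le (by positivity)] at h1
  have hpe : ∀ x, x ≤ c → 0 < g (ε ^ 2 * E x) := by
    intro x hx
    have hEp : 0 < E x := by simp only [hE]; positivity
    refine h.pos hν (by positivity) ?_
    have h2 := hle x hx
    have h3 : ε * Real.exp x ≤ ν := by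
      calc ε * Real.exp x ≤ ε * (ν * Λ) := by gcongr
        _ = ν * (ε * Λ) := by ring
        _ ≤ ν * 1 := by gcongr
        _ = ν := mul_one _
    have h4 : (ε * Real.exp x) ^ 2 ≤ ν ^ 2 := by gcongr
    have := hk2 x
    nlinarith
  set L : ℝ → ℝ := fun x => Real.exp (m * (1 - σ) * x - σ * Real.log (g (ε ^ 2 * E x))) with hL
  set G : ℝ → ℝ := fun x => g (E x) * L x with hG
  have hGd : ∀ x, x ≤ c → HasDerivAt G (g1 (E x) * (2 * E x) * L x + g (E x) * (L x *
      (m * (1 - σ) - σ * ((g1 (ε ^ 2 * E x) * (ε ^ 2 * (2 * E x))) / g (ε ^ 2 * E x))))) x := by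
    intro x hx
    have h1 : HasDerivAt (fun x => g (ε ^ 2 * E x)) (g1 (ε ^ 2 * E x) * (ε ^ 2 * (2 * E x))) x :=
      (h.d1 (ε ^ 2 * E x)).comp x ((hEd x).const_mul _)
    have h2 := ((((hasDerivAt_id x).const_mul (m * (1 - σ))).sub
      ((h1.log (hpe x hx).ne').const_mul σ)).exp)
    have h3 := (hge x).mul h2
    convert! h3 using 1
    simp [hL]
  have hac : a ≤ c := by linarith [ha.2, hc.1]
  have hLp : ∀ x, 0 < L x := fun x => Real.exp_pos _
  obtain ⟨x, hx, hmax⟩ := isCompact_Icc.exists_isMaxOn (nonempty_Icc.2 hac)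
    (fun x hx => (hGd x hx.2).continuousAt.continuousWithinAt : ContinuousOn G (Icc a c))
  have hGb : 0 < G b := mul_pos hgb (hLp b)
  have hGx : 0 < G x := lt_of_lt_of_le hGb
    (hmax ⟨by linarith [ha.2, hb.1], by linarith [hb.2, hc.1]⟩)
  have hgx : 0 < g (E x) := pos_of_mul_pos_left hGx (hLp x).le
  have hxa : a < x := lt_of_le_of_ne hx.1 (by rintro rfl; linarith)
  have hxc : x < c := lt_of_le_of_ne hx.2 (by rintro rfl; linarith)
  have hz := (hmax.isLocalMax (Icc_mem_nhds hxa hxc)).hasDerivAt_eq_zero (hGd x hx.2)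
  have hE4 : Real.exp x ^ 2 / 4 = E x := by rw [← hk2 x]; ring
  refine ⟨Real.exp x, ?_, hle x hx.2, ?_, ?_, ?_⟩
  · have h1 : A ≤ x := by linarith [ha.1]
    rw [hA, Real.log_le_iff_le_exp (by positivity)] at h1
    nlinarith
  · rw [hE4]; exact hgx
  · rw [hE4]; exact hpe x hx.2
  · rw [hE4]
    have h5 := (hLp x).ne'
    have h6 := (hpe x hx.2).ne'
    generalize g (ε ^ 2 * E x) = P at hz h6 ⊢
    generalize g1 (ε ^ 2 * E x) = P1 at hz ⊢
    generalize g (E x) = R at hz ⊢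
    generalize g1 (E x) = R1 at hz ⊢
    generalize L x = l at hz h5
    generalize E x = e at hz ⊢
    have hz2 : l * (σ * (m * P + 2 * (ε ^ 2 * e) * P1) * R) = l * ((m * R + 2 * e * R1) * P) := by
      field_simp at hz
      linear_combination (-1 : ℝ) * hz
    exact mul_left_cancel₀ h5 hz2

lemma fderiv_eq_of_line {N : ℕ} {f : EuclideanSpace ℝ (Fin N) → ℂ}
    {x v : EuclideanSpace ℝ (Fin N)} {d : ℂ} (hf : DifferentiableAt ℝ f x)
    (hd : HasDerivAt (fun s : ℝ => f (x + s • v)) d 0) : fderiv ℝ f x v = d := by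
  have h := (hf.hasFDerivAt.hasLineDerivAt v)
  exact HasDerivAt.unique h hd

lemma line_z {N : ℕ} (z : EuclideanSpace ℝ (Fin N) →L[ℝ] ℂ) (x v : EuclideanSpace ℝ (Fin N)) :
    HasDerivAt (fun s : ℝ => z (x + s • v)) (z v) 0 := by
  have := (z.hasFDerivAt (x := x)).hasLineDerivAt v
  exact this

lemma line_n {N : ℕ} (x v : EuclideanSpace ℝ (Fin N)) :
    HasDerivAt (fun s : ℝ => ‖x + s • v‖ ^ 2) (2 * inner ℝ x v) 0 := by
  have := ((hasStrictFDerivAt_norm_sq x).hasFDerivAt).hasLineDerivAt v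
  simpa [HasLineDerivAt] using this

lemma line_g {N : ℕ} {g g1 : ℝ → ℝ} (hg : ∀ t, HasDerivAt g (g1 t) t) (c : ℝ)
    (x v : EuclideanSpace ℝ (Fin N)) :
    HasDerivAt (fun s : ℝ => ((g (c * ‖x + s • v‖ ^ 2) : ℝ) : ℂ))
      ((g1 (c * ‖x‖ ^ 2) * (c * (2 * inner ℝ x v)) : ℝ) : ℂ) 0 := by
  have h1 := (line_n x v).const_mul c
  have h2 : HasDerivAt g (g1 (c * ‖x‖ ^ 2)) (c * ‖x + (0:ℝ) • v‖ ^ 2) := by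
    simpa using hg (c * ‖x‖ ^ 2)
  exact (h2.comp (0:ℝ) h1).ofReal_comp

/-- The separated solution `α z^m g(c|x|²)`. -/
def sepU {N : ℕ} (z : EuclideanSpace ℝ (Fin N) →L[ℝ] ℂ) (g : ℝ → ℝ) (m : ℕ) (c α : ℝ)
    (x : EuclideanSpace ℝ (Fin N)) : ℂ := (α : ℂ) * (z x ^ m * ((g (c * ‖x‖ ^ 2) : ℝ) : ℂ))

lemma sepU_contDiff {N : ℕ} (z : EuclideanSpace ℝ (Fin N) →L[ℝ] ℂ) {g : ℝ → ℝ}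
    (hg : AnalyticOnNhd ℝ g univ) (m : ℕ) (c α : ℝ) : ContDiff ℝ 2 (sepU z g m c α) := by
  have h1 : ContDiff ℝ 2 g := by
    rw [← contDiffOn_univ]
    exact hg.contDiffOn uniqueDiffOn_univ
  have h2 : ContDiff ℝ 2 (fun x : EuclideanSpace ℝ (Fin N) => c * ‖x‖ ^ 2) :=
    contDiff_const.mul (contDiff_norm_sq ℝ)
  exact contDiff_const.mul ((z.contDiff.pow m).mul (Complex.ofRealCLM.contDiff.comp (h1.comp h2)))

lemma sepU_fderiv {N : ℕ} (z : EuclideanSpace ℝ (Fin N) →L[ℝ] ℂ) {g g1 : ℝ → ℝ}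
    (hg : AnalyticOnNhd ℝ g univ) (hd : ∀ t, HasDerivAt g (g1 t) t) (m : ℕ) (c α : ℝ)
    (x v : EuclideanSpace ℝ (Fin N)) :
    fderiv ℝ (sepU z g m c α) x v = (α : ℂ) * (m * z x ^ (m - 1) * z v * (g (c * ‖x‖ ^ 2) : ℝ)
      + z x ^ m * ((g1 (c * ‖x‖ ^ 2) : ℝ) * (c * (2 * ((inner ℝ x v : ℝ) : ℂ))))) := by
  refine fderiv_eq_of_line ((sepU_contDiff z hg m c α).differentiable (by norm_num) x) ?_
  have := (((line_z z x v).pow m).mul (line_g hd c x v)).const_mul (α : ℂ)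
  convert! this using 1
  simp

lemma sepU_fderiv2 {N : ℕ} (z : EuclideanSpace ℝ (Fin N) →L[ℝ] ℂ) {g g1 g2 : ℝ → ℝ}
    (hg : AnalyticOnNhd ℝ g univ) (hd : ∀ t, HasDerivAt g (g1 t) t)
    (hd1 : ∀ t, HasDerivAt g1 (g2 t) t) (m : ℕ) (c α : ℝ)
    (x v : EuclideanSpace ℝ (Fin N)) (hv : ‖v‖ = 1) :
    fderiv ℝ (fun y => fderiv ℝ (sepU z g m c α) y v) x v =
      (α : ℂ) * (m * (m - 1 : ℕ) * z x ^ (m - 1 - 1) * z v ^ 2 * (g (c * ‖x‖ ^ 2) : ℝ)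
      + 4 * c * m * z x ^ (m - 1) * (g1 (c * ‖x‖ ^ 2) : ℝ) * (z v * ((inner ℝ x v : ℝ) : ℂ))
      + z x ^ m * ((g1 (c * ‖x‖ ^ 2) : ℝ) * (2 * c))
      + z x ^ m * ((g2 (c * ‖x‖ ^ 2) : ℝ) * (4 * c ^ 2)) * ((inner ℝ x v : ℝ) : ℂ) ^ 2) := by
  refine fderiv_eq_of_line ?_ ?_
  · have h1 : ContDiff ℝ 1 (fderiv ℝ (sepU z g m c α)) :=
      (sepU_contDiff z hg m c α).fderiv_right (by norm_num)
    exact (h1.differentiable (by norm_num) x).clm_apply (differentiableAt_const v)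
  · simp only [sepU_fderiv z hg hd]
    have hi : HasDerivAt (fun s : ℝ => ((inner ℝ (x + s • v) v : ℝ) : ℂ)) 1 0 := by
      have : HasDerivAt (fun s : ℝ => (inner ℝ (x + s • v) v : ℝ)) 1 0 := by
        simp only [inner_add_left, inner_smul_left, real_inner_self_eq_norm_sq, hv]
        simpa using (hasDerivAt_id (0:ℝ)).const_add (inner ℝ x v)
      simpa using this.ofReal_comp
    have := ((((((line_z z x v).pow (m - 1)).const_mul (m : ℂ)).mul_const (z v)).mul
      (line_g hd c x v)).add (((line_z z x v).pow m).mul ((line_g hd1 c x v).mul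
        ((hi.const_mul (2:ℂ)).const_mul (c:ℂ))))).const_mul (α : ℂ)
    convert! this using 1
    simp
    left
    ring

lemma sum_inner_sq {N : ℕ} (x : EuclideanSpace ℝ (Fin N)) :
    ∑ i, ((inner ℝ x (EuclideanSpace.single i (1:ℝ)) : ℝ) : ℂ) ^ 2 = ((‖x‖ ^ 2 : ℝ) : ℂ) := by
  rw [EuclideanSpace.norm_sq_eq]
  simp [EuclideanSpace.inner_single_right]

lemma sum_z_inner {N : ℕ} (z : EuclideanSpace ℝ (Fin N) →L[ℝ] ℂ) (x : EuclideanSpace ℝ (Fin N)) :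
    ∑ i, z (EuclideanSpace.single i (1:ℝ)) *
      ((inner ℝ x (EuclideanSpace.single i (1:ℝ)) : ℝ) : ℂ) = z x := by
  have h := (EuclideanSpace.basisFun (Fin N) ℝ).sum_repr x
  conv_rhs => rw [← h]
  rw [map_sum]
  refine Finset.sum_congr rfl fun i _ => ?_
  rw [map_smul]
  simp [EuclideanSpace.inner_single_right]
  ring

lemma sepU_lap {N : ℕ} {z : EuclideanSpace ℝ (Fin N) →L[ℝ] ℂ}
    (hz : ∑ i, z (EuclideanSpace.single i (1:ℝ)) ^ 2 = 0) {ν : ℝ} {g g1 g2 : ℝ → ℝ}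
    (h : Bes ν g g1 g2) (m : ℕ) (hν : ν + 1 = m + (N : ℝ) / 2) (c α : ℝ)
    (x : EuclideanSpace ℝ (Fin N)) :
    lap N (sepU z g m c α) x = -(4 * c * sepU z g m c α x) := by
  unfold lap
  rw [Finset.sum_congr rfl (fun i _ => sepU_fderiv2 z h.an h.d1 h.d2 m c α x
    (EuclideanSpace.single i (1:ℝ)) (by simp))]
  rw [← Finset.mul_sum, Finset.sum_add_distrib, Finset.sum_add_distrib, Finset.sum_add_distrib]
  rw [Finset.sum_const, ← Finset.sum_mul, ← Finset.mul_sum, ← Finset.mul_sum, ← Finset.mul_sum, hz, sum_z_inner,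
    sum_inner_sq]
  have hode : (((c * ‖x‖ ^ 2 * g2 (c * ‖x‖ ^ 2) + (m + (N:ℝ) / 2) * g1 (c * ‖x‖ ^ 2)
      + g (c * ‖x‖ ^ 2) : ℝ)) : ℂ) = 0 := by
    rw [← hν, h.ode]; simp
  have hm : (m : ℂ) * z x ^ (m - 1) * z x = m * z x ^ m := by
    rcases Nat.eq_zero_or_pos m with rfl | hm
    · simp
    · rw [mul_assoc, pow_sub_one_mul hm.ne']
  unfold sepU
  rw [Finset.card_univ, Fintype.card_fin, nsmul_eq_mul]
  push_cast at hode ⊢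
  linear_combination (4 * c * α * z x ^ m) * hode + (4 * c * (g1 (c * ‖x‖ ^ 2) : ℂ) * α) * hm

lemma sepU_div {N : ℕ} {z : EuclideanSpace ℝ (Fin N) →L[ℝ] ℂ} {g : ℝ → ℝ}
    (hg : AnalyticOnNhd ℝ g univ) (m : ℕ) (c α σ : ℝ) (x : EuclideanSpace ℝ (Fin N)) :
    divSigmaGrad N (fun _ => σ) (sepU z g m c α) x = σ * lap N (sepU z g m c α) x := by
  unfold divSigmaGrad lap
  rw [Finset.mul_sum]
  refine Finset.sum_congr rfl fun i _ => ?_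
  have h1 : ContDiff ℝ 1 (fderiv ℝ (sepU z g m c α)) :=
    (sepU_contDiff z hg m c α).fderiv_right (by norm_num)
  have h2 := (h1.differentiable (by norm_num) x).clm_apply
    (differentiableAt_const (EuclideanSpace.single i (1:ℝ)))
  rw [fderiv_const_mul h2]
  simp

lemma sepU_radial {N : ℕ} (z : EuclideanSpace ℝ (Fin N) →L[ℝ] ℂ) {g g1 : ℝ → ℝ}
    (hg : AnalyticOnNhd ℝ g univ) (hd : ∀ t, HasDerivAt g (g1 t) t) (m : ℕ) (c α : ℝ)
    (x : EuclideanSpace ℝ (Fin N)) (hx : ‖x‖ = 1) :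
    fderivWithin ℝ (sepU z g m c α) (closedBall (0 : EuclideanSpace ℝ (Fin N)) 1) x x
      = z x ^ m * ((α * (m * g c + 2 * c * g1 c) : ℝ) : ℂ) := by
  have hu : UniqueDiffWithinAt ℝ (closedBall (0 : EuclideanSpace ℝ (Fin N)) 1) x := by
    refine uniqueDiffWithinAt_convex (convex_closedBall _ _) ?_ ?_
    · exact ⟨0, ball_subset_interior_closedBall (by simp)⟩
    · exact subset_closure (by simp [hx])
  rw [((sepU_contDiff z hg m c α).differentiable (by norm_num) x).fderivWithin hu,
    sepU_fderiv z hg hd]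
  have hm : (m : ℂ) * z x ^ (m - 1) * z x = m * z x ^ m := by
    rcases Nat.eq_zero_or_pos m with rfl | hm
    · simp
    · rw [mul_assoc, pow_sub_one_mul hm.ne']
  rw [real_inner_self_eq_norm_sq, hx]
  push_cast
  rw [hm]
  simp
  ring

lemma ballL2_scale {N : ℕ} {f : EuclideanSpace ℝ (Fin N) → ℂ} (hf : Continuous f)
    {τ μ θ : ℝ} (hμ : 1 ≤ μ) (hτμ : μ * τ ≤ 1) (hθ : 0 ≤ θ)
    (h : ∀ x, ‖x‖ < τ → ‖f x‖ ≤ θ * ‖f (μ • x)‖) :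
    ballL2 N f τ ≤ θ * ballL2 N f 1 := by
  unfold ballL2
  have hI : ∀ (F : EuclideanSpace ℝ (Fin N) → ℝ) (r : ℝ), Continuous F →
      IntegrableOn F (ball 0 r) := fun F r hF =>
    (hF.continuousOn.integrableOn_compact (isCompact_closedBall 0 r)).mono_set ball_subset_closedBall
  rw [← Real.sqrt_sq hθ, ← Real.sqrt_mul (by positivity)]
  refine Real.sqrt_le_sqrt ?_
  have hμ0 : 0 < μ := by linarith
  calc ∫ x in ball (0 : EuclideanSpace ℝ (Fin N)) τ, ‖f x‖ ^ 2
      ≤ ∫ x in ball (0 : EuclideanSpace ℝ (Fin N)) τ, θ ^ 2 * ‖f (μ • x)‖ ^ 2 := by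
        refine setIntegral_mono_on (hI _ _ (by fun_prop)) (hI _ _ (by fun_prop))
          measurableSet_ball ?_
        intro x hx
        rw [← mul_pow]
        have := h x (by simpa using hx)
        gcongr
    _ = θ ^ 2 * ∫ x in ball (0 : EuclideanSpace ℝ (Fin N)) τ, ‖f (μ • x)‖ ^ 2 :=
        integral_const_mul _ _
    _ ≤ θ ^ 2 * ∫ x in ball (0 : EuclideanSpace ℝ (Fin N)) 1, ‖f x‖ ^ 2 := by
        gcongr
        rw [Measure.setIntegral_comp_smul volume (fun x => ‖f x‖ ^ 2) _ hμ0.ne',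
          _root_.smul_ball hμ0.ne', smul_zero, Real.norm_of_nonneg hμ0.le, smul_eq_mul]
        have h1 : |(μ ^ Module.finrank ℝ (EuclideanSpace ℝ (Fin N)))⁻¹| ≤ 1 := by
          rw [abs_of_nonneg (by positivity)]
          exact inv_le_one_of_one_le₀ (one_le_pow₀ hμ)
        have h2 : ∫ x in ball (0 : EuclideanSpace ℝ (Fin N)) (μ * τ), ‖f x‖ ^ 2
            ≤ ∫ x in ball (0 : EuclideanSpace ℝ (Fin N)) 1, ‖f x‖ ^ 2 :=
          setIntegral_mono_set (hI _ _ (by fun_prop)) (ae_of_all _ fun x => by positivity)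
            (ball_subset_ball hτμ).eventuallyLE
        have h3 : 0 ≤ ∫ x in ball (0 : EuclideanSpace ℝ (Fin N)) (μ * τ), ‖f x‖ ^ 2 :=
          integral_nonneg fun x => by positivity
        calc _ ≤ 1 * ∫ x in ball (0 : EuclideanSpace ℝ (Fin N)) (μ * τ), ‖f x‖ ^ 2 := by gcongr
          _ ≤ _ := by rw [one_mul]; exact h2

lemma sepU_local {N : ℕ} (z : EuclideanSpace ℝ (Fin N) →L[ℝ] ℂ) {ν : ℝ} {g g1 g2 : ℝ → ℝ}
    (h : Bes ν g g1 g2) (hν : 0 < ν) (m : ℕ) (hνm : ν ≤ m + 1) (c α : ℝ) (hc : 0 ≤ c)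
    {ρ μ τ : ℝ} (hρ : 0 ≤ ρ) (hμ : 1 ≤ μ) (hτ : 0 ≤ τ) (hμτ : μ * τ ≤ 1)
    (hT : 4 * (c * (μ * τ) ^ 2) ≤ ν ^ 2 - ρ ^ 2) :
    ballL2 N (sepU z g m c α) τ ≤ μ ^ (1 - ρ) * ballL2 N (sepU z g m c α) 1 := by
  have hμ0 : 0 < μ := by linarith
  refine ballL2_scale (sepU_contDiff z h.an m c α).continuous hμ hμτ
    (Real.rpow_nonneg hμ0.le _) ?_
  intro x hx
  have hx2 : ‖x‖ ^ 2 ≤ τ ^ 2 := by gcongr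
  have ht : 0 ≤ c * ‖x‖ ^ 2 := by positivity
  obtain ⟨hg0, hg⟩ := h.scale hν hρ hT hμ ht (by
    calc μ ^ 2 * (c * ‖x‖ ^ 2) ≤ μ ^ 2 * (c * τ ^ 2) := by gcongr
      _ = c * (μ * τ) ^ 2 := by ring)
  have hgp : 0 ≤ g (μ ^ 2 * (c * ‖x‖ ^ 2)) := by
    have hp : 0 < μ ^ (ν - ρ) := Real.rpow_pos_of_pos hμ0 _
    exact nonneg_of_mul_nonneg_right (hg0.trans hg) hp
  have e : c * ‖μ • x‖ ^ 2 = μ ^ 2 * (c * ‖x‖ ^ 2) := by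
    rw [norm_smul, Real.norm_of_nonneg hμ0.le]; ring
  have hpow : μ ^ (ν - ρ) ≤ μ ^ (1 - ρ) * μ ^ m := by
    rw [← Real.rpow_natCast μ m, ← Real.rpow_add hμ0]
    exact Real.rpow_le_rpow_of_exponent_le hμ (by linarith)
  have hle : g (c * ‖x‖ ^ 2) ≤ μ ^ (1 - ρ) * μ ^ m * g (μ ^ 2 * (c * ‖x‖ ^ 2)) :=
    hg.trans (by gcongr)
  unfold sepU
  rw [e, map_smul]
  simp only [norm_mul, norm_pow, Complex.norm_real, norm_smul, Real.norm_of_nonneg hg0,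
    Real.norm_of_nonneg hgp, Real.norm_of_nonneg hμ0.le]
  calc ‖α‖ * (‖z x‖ ^ m * g (c * ‖x‖ ^ 2))
      ≤ ‖α‖ * (‖z x‖ ^ m * (μ ^ (1 - ρ) * μ ^ m * g (μ ^ 2 * (c * ‖x‖ ^ 2)))) := by gcongr
    _ = _ := by ring

lemma exists_z {N : ℕ} (hN : N = 2 ∨ N = 3) : ∃ z : EuclideanSpace ℝ (Fin N) →L[ℝ] ℂ,
    ∑ i, z (EuclideanSpace.single i (1:ℝ)) ^ 2 = 0 ∧ ∃ x, ‖x‖ = 1 ∧ z x = 1 := by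
  rcases hN with rfl | rfl
  · refine ⟨(EuclideanSpace.proj (𝕜 := ℝ) (0 : Fin 2)).smulRight (1:ℂ)
      + (EuclideanSpace.proj (𝕜 := ℝ) (1 : Fin 2)).smulRight Complex.I, ?_,
      EuclideanSpace.single 0 1, by simp, by simp⟩
    simp [Fin.sum_univ_two]
  · refine ⟨(EuclideanSpace.proj (𝕜 := ℝ) (0 : Fin 3)).smulRight (1:ℂ)
      + (EuclideanSpace.proj (𝕜 := ℝ) (1 : Fin 3)).smulRight Complex.I, ?_,
      EuclideanSpace.single 0 1, by simp, by simp⟩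
    simp [Fin.sum_univ_three]

lemma main_step {N : ℕ} (hN : N = 2 ∨ N = 3) {σ n τ : ℝ}
    (hτ : τ ∈ Ioo (0:ℝ) 1) {Λ Λ0 γ μ ε : ℝ} (hε : 0 < ε) (hε1 : ε ≤ 1) (hεe : σ * ε ^ 2 = n ^ 2)
    (hΛ0 : 1 < Λ0) (hΛ : 0 < Λ) (hεΛ : ε * Λ ≤ 1) (hγ : 0 ≤ γ) (hμ : 1 ≤ μ) (hμτ : μ * τ ≤ 1)
    (hγe : γ ^ 2 + (Λ * (μ * τ)) ^ 2 ≤ 1) (m : ℕ) (hm : 1 ≤ m)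
    (hlog : Real.log Λ0 + 3 * (Real.pi / (m * Real.sqrt (Λ0 ^ 2 - 1))) ≤ Real.log Λ) :
    ∃ (k : ℝ) (u v : EuclideanSpace ℝ (Fin N) → ℂ), (m : ℝ) ≤ k ∧
      IsTransmissionEigenpair N k (fun _ => σ) (fun _ => n) u v ∧
      ¬ EqOn u 0 (closedBall (0 : EuclideanSpace ℝ (Fin N)) 1) ∧
      ¬ EqOn v 0 (closedBall (0 : EuclideanSpace ℝ (Fin N)) 1) ∧
      ballL2 N u τ / ballL2 N u 1 ≤ μ ^ (1 - γ * m) ∧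
      ballL2 N v τ / ballL2 N v 1 ≤ μ ^ (1 - γ * m) := by
  obtain ⟨z, hz, x0, hx0, hzx0⟩ := exists_z hN
  set ν : ℝ := m + (N : ℝ) / 2 - 1 with hν
  have hm1 : (1:ℝ) ≤ m := by exact_mod_cast hm
  have hνm : (m : ℝ) ≤ ν ∧ ν ≤ m + 1 := by
    rcases hN with rfl | rfl <;> constructor <;> rw [hν] <;> push_cast <;> linarith
  have hν0 : 0 < ν := by linarith
  obtain ⟨g, g1, g2, b1, b2, b3, b4, b5⟩ := exists_bessel (a := ν + 1) (by linarith)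
  have h : Bes ν g g1 g2 := ⟨b1, b2, b3, b4, b5⟩
  have hs : 0 < Real.sqrt (Λ0 ^ 2 - 1) := Real.sqrt_pos.2 (by nlinarith)
  have hL := h.eig hν0 (m := m) (σ := σ) (ε := ε) (Λ := Λ) (Λ0 := Λ0)
    (q := ν * Real.sqrt (Λ0 ^ 2 - 1)) hε hΛ0 (by positivity)
    (by rw [mul_pow, Real.sq_sqrt (by nlinarith)]) hΛ hεΛ (by
      rw [Real.log_mul hν0.ne' (by linarith), Real.log_mul hν0.ne' hΛ.ne']
      have h1 : Real.pi / (ν * Real.sqrt (Λ0 ^ 2 - 1))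
          ≤ Real.pi / (m * Real.sqrt (Λ0 ^ 2 - 1)) := by
        have := Real.pi_pos
        gcongr
        exact hνm.1
      linarith)
  obtain ⟨k, hk1, hk2, hp1, hp2, heq⟩ := hL
  set s := k ^ 2 / 4 with hsdef
  have hk0 : 0 < k := by linarith
  have hs0 : 0 ≤ s := by positivity
  set u := sepU z g m (ε ^ 2 * s) (g s) with hu
  set v := sepU z g m s (g (ε ^ 2 * s)) with hv
  have hux : ∀ x : EuclideanSpace ℝ (Fin N), ‖x‖ = 1 → u x = v x := by
    intro x hx
    simp only [hu, hv, sepU, hx]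
    simp
    ring
  have hune : u x0 ≠ 0 := by
    simp only [hu, sepU, hx0, hzx0]
    simp [hp1.ne', hp2.ne']
  have hvne : v x0 ≠ 0 := hux x0 hx0 ▸ hune
  have hx0m : x0 ∈ closedBall (0 : EuclideanSpace ℝ (Fin N)) 1 := by simp [hx0]
  have hu0 : ¬ EqOn u 0 (closedBall (0 : EuclideanSpace ℝ (Fin N)) 1) := fun hc => hune (hc hx0m)
  have hv0 : ¬ EqOn v 0 (closedBall (0 : EuclideanSpace ℝ (Fin N)) 1) := fun hc => hvne (hc hx0m)
  have hcu : ContDiff ℝ 2 u := sepU_contDiff z h.an _ _ _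
  have hcv : ContDiff ℝ 2 v := sepU_contDiff z h.an _ _ _
  have hνN : ν + 1 = m + (N : ℝ) / 2 := by rw [hν]; ring
  have hrad : 4 * (s * (μ * τ) ^ 2) ≤ ν ^ 2 - (γ * ν) ^ 2 := by
    have h1 : 4 * s = k ^ 2 := by rw [hsdef]; ring
    have h2 : k ^ 2 ≤ (ν * Λ) ^ 2 := by gcongr
    calc 4 * (s * (μ * τ) ^ 2) = k ^ 2 * (μ * τ) ^ 2 := by rw [← h1]; ring
      _ ≤ (ν * Λ) ^ 2 * (μ * τ) ^ 2 := by gcongr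
      _ = ν ^ 2 * (Λ * (μ * τ)) ^ 2 := by ring
      _ ≤ ν ^ 2 * (1 - γ ^ 2) := by gcongr; linarith
      _ = _ := by ring
  have hε2 : ε ^ 2 ≤ 1 := pow_le_one₀ hε.le hε1
  have hrad' : 4 * ((ε ^ 2 * s) * (μ * τ) ^ 2) ≤ ν ^ 2 - (γ * ν) ^ 2 := by
    refine le_trans ?_ hrad
    have : 0 ≤ 4 * (s * (μ * τ) ^ 2) := by positivity
    nlinarith
  have hμ0 : 0 < μ := by linarith
  have hexp : μ ^ (1 - γ * ν) ≤ μ ^ (1 - γ * m) :=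
    Real.rpow_le_rpow_of_exponent_le hμ (by nlinarith [hνm.1])
  have hdiv : ∀ f : EuclideanSpace ℝ (Fin N) → ℂ,
      ballL2 N f τ ≤ μ ^ (1 - γ * ν) * ballL2 N f 1 →
      ballL2 N f τ / ballL2 N f 1 ≤ μ ^ (1 - γ * m) := fun f hf =>
    (div_le_of_le_mul₀ (Real.sqrt_nonneg _) (Real.rpow_nonneg hμ0.le _) hf).trans hexp
  refine ⟨k, u, v, hνm.1.trans hk1, ⟨hcu.contDiffOn, (hcu.of_le (by norm_num)).contDiffOn,
    hcv.contDiffOn, (hcv.of_le (by norm_num)).contDiffOn, ?_, ?_, hux, ?_, fun hc => hu0 hc.1⟩,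
    hu0, hv0, hdiv u ?_, hdiv v ?_⟩
  · intro x _
    rw [hu, sepU_div h.an, sepU_lap hz h m hνN]
    have hεc : (σ : ℂ) * (ε : ℂ) ^ 2 = (n : ℂ) ^ 2 := by exact_mod_cast hεe
    have hsc : (s : ℂ) = (k : ℂ) ^ 2 / 4 := by rw [hsdef]; push_cast; ring
    push_cast
    rw [hsc]
    generalize sepU z g m (ε ^ 2 * s) (g s) x = w
    linear_combination (-(k : ℂ) ^ 2 * w) * hεc
  · intro x _
    rw [hv, sepU_lap hz h m hνN]
    have hsc : (s : ℂ) = (k : ℂ) ^ 2 / 4 := by rw [hsdef]; push_cast; ring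
    rw [hsc]
    ring
  · intro x hx
    rw [hu, hv, sepU_radial z h.an h.d1 _ _ _ x hx, sepU_radial z h.an h.d1 _ _ _ x hx]
    have hc := congrArg (fun r : ℝ => (r : ℂ)) heq
    push_cast at hc ⊢
    linear_combination (z x ^ m) * hc
  · exact sepU_local z h hν0 m hνm.2 _ _ (by positivity) (by positivity) hμ hτ.1.le hμτ hrad'
  · exact sepU_local z h hν0 m hνm.2 _ _ hs0 (by positivity) hμ hτ.1.le hμτ hrad

/-- Boundary localization of both the `u`- and `v`-parts of transmission eigenfunctions
for constant media with `n² < σ` on the unit ball. -/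
theorem boundary_localization_constant
    (N : ℕ) (hN : N = 2 ∨ N = 3) (σ n : ℝ) (hσ : 0 < σ) (hn : 0 < n)
    (hns : n ^ 2 < σ) (τ : ℝ) (hτ : τ ∈ Ioo (0:ℝ) 1) :
    ∃ (k : ℕ → ℝ) (u v : ℕ → EuclideanSpace ℝ (Fin N) → ℂ),
      (∀ m, 0 < k m) ∧
      Tendsto k atTop atTop ∧
      (∀ m, IsTransmissionEigenpair N (k m) (fun _ => σ) (fun _ => n) (u m) (v m)) ∧
      (∀ m, ¬ EqOn (u m) 0 (closedBall (0 : EuclideanSpace ℝ (Fin N)) 1)) ∧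
      (∀ m, ¬ EqOn (v m) 0 (closedBall (0 : EuclideanSpace ℝ (Fin N)) 1)) ∧
      Tendsto (fun m => ballL2 N (u m) τ / ballL2 N (u m) 1) atTop (nhds 0) ∧
      Tendsto (fun m => ballL2 N (v m) τ / ballL2 N (v m) 1) atTop (nhds 0) := by
  obtain ⟨hτ0, hτ1⟩ := hτ
  set ε : ℝ := n / Real.sqrt σ with hε
  have hsσ : 0 < Real.sqrt σ := Real.sqrt_pos.2 hσ
  have hε0 : 0 < ε := by positivity
  have hεe : σ * ε ^ 2 = n ^ 2 := by
    rw [hε, div_pow, Real.sq_sqrt hσ.le]; field_simp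
  have hε1 : ε < 1 := by
    rw [hε, div_lt_one hsσ]
    exact Real.lt_sqrt_of_sq_lt hns
  set τ1 : ℝ := (1 + τ) / 2 with hτ1d
  set M : ℝ := max ε τ1 with hM
  have hM1 : M < 1 := max_lt hε1 (by rw [hτ1d]; linarith)
  have hMε : ε ≤ M := le_max_left _ _
  have hMτ : τ1 ≤ M := le_max_right _ _
  have hM0 : 0 < M := hε0.trans_le hMε
  set Λ : ℝ := 2 / (1 + M) with hΛ
  have hΛ1 : 1 < Λ := by rw [hΛ, lt_div_iff₀ (by linarith)]; linarith
  have hΛM : M * Λ < 1 := by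
    rw [hΛ, ← mul_div_assoc, div_lt_one (by linarith)]; linarith
  set Λ0 : ℝ := (1 + Λ) / 2 with hΛ0
  have hΛ01 : 1 < Λ0 := by rw [hΛ0]; linarith
  have hΛΛ : Λ0 < Λ := by rw [hΛ0]; linarith
  set μ : ℝ := τ1 / τ with hμ
  have hμ1 : 1 < μ := by rw [hμ, lt_div_iff₀ hτ0, hτ1d]; linarith
  have hμτ : μ * τ = τ1 := by rw [hμ]; field_simp
  have hτ1p : 0 < τ1 := by rw [hτ1d]; linarith
  have hΛτ : Λ * τ1 < 1 := by nlinarith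
  have hΛτ2 : (Λ * τ1) ^ 2 < 1 := pow_lt_one₀ (by positivity) hΛτ (by norm_num)
  set γ : ℝ := Real.sqrt (1 - (Λ * τ1) ^ 2) with hγ
  have hγ0 : 0 < γ := Real.sqrt_pos.2 (by linarith)
  have hlogp : 0 < Real.log Λ - Real.log Λ0 := by
    have := Real.log_lt_log (by linarith) hΛΛ
    linarith
  have hs : 0 < Real.sqrt (Λ0 ^ 2 - 1) := Real.sqrt_pos.2 (by nlinarith)
  obtain ⟨M0, hM0b⟩ := exists_nat_ge
    (3 * Real.pi / (Real.sqrt (Λ0 ^ 2 - 1) * (Real.log Λ - Real.log Λ0)))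
  have key : ∀ m : ℕ, ∃ (k : ℝ) (u v : EuclideanSpace ℝ (Fin N) → ℂ),
      ((m + 1 + M0 : ℕ) : ℝ) ≤ k ∧
      IsTransmissionEigenpair N k (fun _ => σ) (fun _ => n) u v ∧
      ¬ EqOn u 0 (closedBall (0 : EuclideanSpace ℝ (Fin N)) 1) ∧
      ¬ EqOn v 0 (closedBall (0 : EuclideanSpace ℝ (Fin N)) 1) ∧
      ballL2 N u τ / ballL2 N u 1 ≤ μ ^ (1 - γ * (m + 1 + M0 : ℕ)) ∧
      ballL2 N v τ / ballL2 N v 1 ≤ μ ^ (1 - γ * (m + 1 + M0 : ℕ)) := by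
    intro m
    refine main_step hN ⟨hτ0, hτ1⟩ hε0 hε1.le hεe hΛ01 (zero_lt_one.trans hΛ1) ?_ hγ0.le hμ1.le ?_ ?_
      (m + 1 + M0) (by omega) ?_
    · nlinarith
    · rw [hμτ, hτ1d]; linarith
    · rw [hμτ, hγ, Real.sq_sqrt (by linarith)]; linarith
    · have h1 : 3 * Real.pi / (Real.sqrt (Λ0 ^ 2 - 1) * (Real.log Λ - Real.log Λ0))
          ≤ ((m + 1 + M0 : ℕ) : ℝ) := by
        refine hM0b.trans ?_
        exact_mod_cast (by omega : M0 ≤ m + 1 + M0)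
      rw [div_le_iff₀ (by positivity)] at h1
      have hmp : (0:ℝ) < ((m + 1 + M0 : ℕ) : ℝ) := by exact_mod_cast (by omega : 0 < m + 1 + M0)
      have h2 : 3 * (Real.pi / (((m + 1 + M0 : ℕ) : ℝ) * Real.sqrt (Λ0 ^ 2 - 1)))
          ≤ Real.log Λ - Real.log Λ0 := by
        rw [← mul_div_assoc, div_le_iff₀ (by positivity)]
        linarith
      linarith
  choose k u v hk he hu hv hbu hbv using key
  have hkm : ∀ m : ℕ, (m : ℝ) + 1 ≤ k m := fun m => by
    refine le_trans ?_ (hk m)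
    exact_mod_cast (by omega : m + 1 ≤ m + 1 + M0)
  have hbound : ∀ m : ℕ, μ ^ (1 - γ * (m + 1 + M0 : ℕ)) ≤ μ * (μ ^ (-γ)) ^ m := by
    intro m
    have hμ0 : 0 < μ := by linarith
    rw [← Real.rpow_natCast (μ ^ (-γ)) m, ← Real.rpow_mul hμ0.le]
    nth_rewrite 2 [← Real.rpow_one μ]
    rw [← Real.rpow_add hμ0]
    refine Real.rpow_le_rpow_of_exponent_le hμ1.le ?_
    have : (m : ℝ) ≤ ((m + 1 + M0 : ℕ) : ℝ) := by exact_mod_cast (by omega : m ≤ m + 1 + M0)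
    nlinarith
  have hlim : Tendsto (fun m : ℕ => μ * (μ ^ (-γ)) ^ m) atTop (nhds 0) := by
    have h1 : μ ^ (-γ) < 1 := Real.rpow_lt_one_of_one_lt_of_neg hμ1 (by linarith)
    have := (tendsto_pow_atTop_nhds_zero_of_lt_one (Real.rpow_nonneg (by linarith) _) h1).const_mul μ
    simpa using this
  have hnn : ∀ f : EuclideanSpace ℝ (Fin N) → ℂ, 0 ≤ ballL2 N f τ / ballL2 N f 1 :=
    fun f => div_nonneg (Real.sqrt_nonneg _) (Real.sqrt_nonneg _)
  refine ⟨k, u, v, fun m => ?_, ?_, he, hu, hv, ?_, ?_⟩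
  · have : (0:ℝ) ≤ m := by positivity
    linarith [hkm m]
  · exact tendsto_atTop_mono (fun m => by linarith [hkm m]) tendsto_natCast_atTop_atTop
  · exact squeeze_zero (fun m => hnn _) (fun m => (hbu m).trans (hbound m)) hlim
  · exact squeeze_zero (fun m => hnn _) (fun m => (hbv m).trans (hbound m)) hlim

end
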